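/- (Energy, uniform-in-time bound.) Let 0<L_s<∞. There exists a constant C=C(Γ)>0 such that every classical solution of the Boussinesq system with 0≤T₀≤1 satisfies ‖u(t)‖_{L²} ≤ ‖u₀‖_{L²} + C·max{1,L_s}·Ra for all t≥0. If L_s=∞ and the spatial average of u₁(0,·) vanishes, then ‖u(t)‖_{L²} ≤ ‖u₀‖_{L²} + C·Ra for all t≥0. -/

import Mathlib

noncomputable section
open MeasureTheory Filter Set
open scoped ENNReal

namespace RB

/-- A time-dependent scalar field: arguments t, x₁, x₂. -/
abbrev TField := ℝ → ℝ → ℝ → ℝ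
/-- A static scalar field: arguments x₁, x₂. -/
abbrev SField := ℝ → ℝ → ℝ

def tsmooth (f : TField) : Prop :=
  ContDiff ℝ (⊤ : ℕ∞) (fun q : ℝ × ℝ × ℝ => f q.1 q.2.1 q.2.2)
def ssmooth (f : SField) : Prop :=
  ContDiff ℝ (⊤ : ℕ∞) (fun q : ℝ × ℝ => f q.1 q.2)
def tperiodic (Γ : ℝ) (f : TField) : Prop := ∀ t x1 x2, f t (x1 + Γ) x2 = f t x1 x2
def speriodic (Γ : ℝ) (f : SField) : Prop := ∀ x1 x2, f (x1 + Γ) x2 = f x1 x2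

/-- time derivative -/
def dt (f : TField) : TField := fun t x1 x2 => deriv (fun s => f s x1 x2) t
/-- partial derivative in x₁ (time-dependent field) -/
def d1 (f : TField) : TField := fun t x1 x2 => deriv (fun y => f t y x2) x1
/-- partial derivative in x₂ (time-dependent field) -/
def d2 (f : TField) : TField := fun t x1 x2 => deriv (fun y => f t x1 y) x2
/-- partial derivative in x₁ (static field) -/
def q1 (f : SField) : SField := fun x1 x2 => deriv (fun y => f y x2) x1
/-- partial derivative in x₂ (static field) -/
def q2 (f : SField) : SField := fun x1 x2 => deriv (fun y => f x1 y) x2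

/-- Integral over Ω = [0,Γ]×[0,1]. -/
def intΩ (Γ : ℝ) (g : SField) : ℝ :=
  ∫ x1 in Ioc (0:ℝ) Γ, ∫ x2 in Ioc (0:ℝ) 1, g x1 x2

/-- Long-time horizontal average ⟨f⟩ of a quantity f(t, x₁). -/
def ltavg (Γ : ℝ) (f : ℝ → ℝ → ℝ) : ℝ :=
  limsup (fun t => (1/t) * ∫ s in Ioc (0:ℝ) t, (1/Γ) * ∫ x1 in Ioc (0:ℝ) Γ, f s x1) atTop

/-- spatial L² norm of a static scalar field over Ω -/
def sL2 (Γ : ℝ) (f : SField) : ℝ := Real.sqrt (intΩ Γ (fun x1 x2 => f x1 x2 ^ 2))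
/-- spatial L^r norm of a static scalar field over Ω -/
def sLr (Γ r : ℝ) (f : SField) : ℝ := (intΩ Γ (fun x1 x2 => |f x1 x2| ^ r)) ^ (1/r)
/-- H¹ norm of a static scalar field over Ω -/
def sH1 (Γ : ℝ) (f : SField) : ℝ :=
  Real.sqrt (intΩ Γ (fun x1 x2 => f x1 x2 ^ 2 + q1 f x1 x2 ^ 2 + q2 f x1 x2 ^ 2))

/-- A classical solution of the Boussinesq system on Ω = [0,Γ]×[0,1] with
Rayleigh number Ra, Prandtl number Pr, slip length Ls ∈ (0,∞]
(Navier-slip with friction coefficient `(Ls⁻¹).toReal`; for Ls = ∞ this is free-slip). -/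
structure Sol (Γ Ra Pr : ℝ) (Ls : ℝ≥0∞) where
  u1 : TField
  u2 : TField
  T : TField
  p : TField
  smooth_u1 : tsmooth u1
  smooth_u2 : tsmooth u2
  smooth_T : tsmooth T
  smooth_p : tsmooth p
  periodic_u1 : tperiodic Γ u1
  periodic_u2 : tperiodic Γ u2
  periodic_T : tperiodic Γ T
  periodic_p : tperiodic Γ p
  momentum1 : ∀ t x1 x2, 0 ≤ t → x2 ∈ Icc (0:ℝ) 1 →
    Pr⁻¹ * (dt u1 t x1 x2 + u1 t x1 x2 * d1 u1 t x1 x2 + u2 t x1 x2 * d2 u1 t x1 x2)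
      - (d1 (d1 u1) t x1 x2 + d2 (d2 u1) t x1 x2) + d1 p t x1 x2 = 0
  momentum2 : ∀ t x1 x2, 0 ≤ t → x2 ∈ Icc (0:ℝ) 1 →
    Pr⁻¹ * (dt u2 t x1 x2 + u1 t x1 x2 * d1 u2 t x1 x2 + u2 t x1 x2 * d2 u2 t x1 x2)
      - (d1 (d1 u2) t x1 x2 + d2 (d2 u2) t x1 x2) + d2 p t x1 x2 = Ra * T t x1 x2
  incomp : ∀ t x1 x2, 0 ≤ t → x2 ∈ Icc (0:ℝ) 1 →
    d1 u1 t x1 x2 + d2 u2 t x1 x2 = 0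
  heat : ∀ t x1 x2, 0 ≤ t → x2 ∈ Icc (0:ℝ) 1 →
    dt T t x1 x2 + u1 t x1 x2 * d1 T t x1 x2 + u2 t x1 x2 * d2 T t x1 x2
      - (d1 (d1 T) t x1 x2 + d2 (d2 T) t x1 x2) = 0
  T_bot : ∀ t x1, 0 ≤ t → T t x1 0 = 1
  T_top : ∀ t x1, 0 ≤ t → T t x1 1 = 0
  u2_bot : ∀ t x1, 0 ≤ t → u2 t x1 0 = 0
  u2_top : ∀ t x1, 0 ≤ t → u2 t x1 1 = 0
  slip_top : ∀ t x1, 0 ≤ t → d2 u1 t x1 1 = -(Ls⁻¹).toReal * u1 t x1 1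
  slip_bot : ∀ t x1, 0 ≤ t → d2 u1 t x1 0 = (Ls⁻¹).toReal * u1 t x1 0

variable {Γ Ra Pr : ℝ} {Ls : ℝ≥0∞}

/-- The Nusselt number Nu = ⟨∫₀¹ (u₂T − ∂₂T) dx₂⟩. -/
def Nu (S : Sol Γ Ra Pr Ls) : ℝ :=
  ltavg Γ (fun t x1 => ∫ x2 in (0:ℝ)..1, (S.u2 t x1 x2 * S.T t x1 x2 - d2 S.T t x1 x2))

/-- The initial temperature satisfies 0 ≤ T₀ ≤ 1 on Ω. -/
def T0cond (S : Sol Γ Ra Pr Ls) : Prop :=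
  ∀ x1 x2, x2 ∈ Icc (0:ℝ) 1 → S.T 0 x1 x2 ∈ Icc (0:ℝ) 1

/-- The vorticity ω = ∂₁u₂ − ∂₂u₁. -/
def vort (S : Sol Γ Ra Pr Ls) : TField :=
  fun t x1 x2 => d1 S.u2 t x1 x2 - d2 S.u1 t x1 x2

/-- |∇u|² pointwise. -/
def gradSq (S : Sol Γ Ra Pr Ls) : TField := fun t x1 x2 =>
  d1 S.u1 t x1 x2 ^ 2 + d2 S.u1 t x1 x2 ^ 2 + d1 S.u2 t x1 x2 ^ 2 + d2 S.u2 t x1 x2 ^ 2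

/-- |∇²u|² pointwise: sum of squares of all second spatial derivatives of u. -/
def hessSq (S : Sol Γ Ra Pr Ls) : TField := fun t x1 x2 =>
  d1 (d1 S.u1) t x1 x2 ^ 2 + d1 (d2 S.u1) t x1 x2 ^ 2 +
  d2 (d1 S.u1) t x1 x2 ^ 2 + d2 (d2 S.u1) t x1 x2 ^ 2 +
  d1 (d1 S.u2) t x1 x2 ^ 2 + d1 (d2 S.u2) t x1 x2 ^ 2 +
  d2 (d1 S.u2) t x1 x2 ^ 2 + d2 (d2 S.u2) t x1 x2 ^ 2

/-- ‖u(t)‖_{L²}. -/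
def uL2 (S : Sol Γ Ra Pr Ls) (t : ℝ) : ℝ :=
  Real.sqrt (intΩ Γ (fun x1 x2 => S.u1 t x1 x2 ^ 2 + S.u2 t x1 x2 ^ 2))

/-- ‖u₀‖_{W^{1,4}}. -/
def W14u0 (S : Sol Γ Ra Pr Ls) : ℝ :=
  (intΩ Γ (fun x1 x2 =>
    (S.u1 0 x1 x2 ^ 2 + S.u2 0 x1 x2 ^ 2) ^ 2 + (gradSq S 0 x1 x2) ^ 2)) ^ ((1:ℝ)/4)

/-- ‖ω(t)‖_{L⁴}. -/
def omegaL4 (S : Sol Γ Ra Pr Ls) (t : ℝ) : ℝ :=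
  (intΩ Γ (fun x1 x2 => vort S t x1 x2 ^ 4)) ^ ((1:ℝ)/4)



lemma tsmooth.cont {f : TField} (hf : tsmooth f) :
    Continuous (fun q : ℝ × ℝ × ℝ => f q.1 q.2.1 q.2.2) := ContDiff.continuous hf

lemma tsmooth.diff {f : TField} (hf : tsmooth f) (q : ℝ × ℝ × ℝ) :
    DifferentiableAt ℝ (fun q : ℝ × ℝ × ℝ => f q.1 q.2.1 q.2.2) q :=
  (ContDiff.differentiable hf (by simp)) q

lemma has_aux {f : TField} (hf : tsmooth f) (t x y : ℝ) {c : ℝ → ℝ × ℝ × ℝ} {v : ℝ × ℝ × ℝ}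
    {s : ℝ} (hc : HasDerivAt c v s) (hcs : c s = (t, x, y)) :
    HasDerivAt (fun r => f (c r).1 (c r).2.1 (c r).2.2)
      (fderiv ℝ (fun q : ℝ × ℝ × ℝ => f q.1 q.2.1 q.2.2) (t, x, y) v) s := by
  have h := (hf.diff (t, x, y)).hasFDerivAt
  rw [← hcs] at h
  have := h.comp_hasDerivAt s hc
  rw [hcs] at this
  exact this

lemma has_t {f : TField} (hf : tsmooth f) (t x y : ℝ) :
    HasDerivAt (fun r => f r x y)
      (fderiv ℝ (fun q : ℝ × ℝ × ℝ => f q.1 q.2.1 q.2.2) (t, x, y) (1, 0, 0)) t :=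
  has_aux hf t x y (c := fun r => (r, x, y))
    ((hasDerivAt_id t).prodMk ((hasDerivAt_const t x).prodMk (hasDerivAt_const t y))) rfl
lemma has_1 {f : TField} (hf : tsmooth f) (t x y : ℝ) :
    HasDerivAt (fun r => f t r y)
      (fderiv ℝ (fun q : ℝ × ℝ × ℝ => f q.1 q.2.1 q.2.2) (t, x, y) (0, 1, 0)) x :=
  has_aux hf t x y (c := fun r => (t, r, y))
    ((hasDerivAt_const x t).prodMk ((hasDerivAt_id x).prodMk (hasDerivAt_const x y))) rfl
lemma has_2 {f : TField} (hf : tsmooth f) (t x y : ℝ) :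
    HasDerivAt (fun r => f t x r)
      (fderiv ℝ (fun q : ℝ × ℝ × ℝ => f q.1 q.2.1 q.2.2) (t, x, y) (0, 0, 1)) y :=
  has_aux hf t x y (c := fun r => (t, x, r))
    ((hasDerivAt_const y t).prodMk ((hasDerivAt_const y x).prodMk (hasDerivAt_id y))) rfl

lemma tsmooth.hdt {f : TField} (hf : tsmooth f) (t x y : ℝ) :
    HasDerivAt (fun r => f r x y) (dt f t x y) t := (has_t hf t x y).differentiableAt.hasDerivAt
lemma tsmooth.hd1 {f : TField} (hf : tsmooth f) (t x y : ℝ) :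
    HasDerivAt (fun r => f t r y) (d1 f t x y) x := (has_1 hf t x y).differentiableAt.hasDerivAt
lemma tsmooth.hd2 {f : TField} (hf : tsmooth f) (t x y : ℝ) :
    HasDerivAt (fun r => f t x r) (d2 f t x y) y := (has_2 hf t x y).differentiableAt.hasDerivAt

lemma smooth_aux {f : TField} (hf : tsmooth f) (v : ℝ × ℝ × ℝ) :
    ContDiff ℝ (⊤ : ℕ∞) (fun q : ℝ × ℝ × ℝ =>
      fderiv ℝ (fun q : ℝ × ℝ × ℝ => f q.1 q.2.1 q.2.2) q v) :=
  (ContDiff.fderiv_right (m := (⊤ : ℕ∞)) hf (by simp)).clm_apply contDiff_const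

lemma tsmooth.dt {f : TField} (hf : tsmooth f) : tsmooth (dt f) := by
  have h := smooth_aux hf (1, 0, 0)
  unfold tsmooth
  convert h using 2 with q
  exact (has_t hf q.1 q.2.1 q.2.2).deriv
lemma tsmooth.d1 {f : TField} (hf : tsmooth f) : tsmooth (d1 f) := by
  have h := smooth_aux hf (0, 1, 0)
  unfold tsmooth
  convert h using 2 with q
  exact (has_1 hf q.1 q.2.1 q.2.2).deriv
lemma tsmooth.d2 {f : TField} (hf : tsmooth f) : tsmooth (d2 f) := by
  have h := smooth_aux hf (0, 0, 1)
  unfold tsmooth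
  convert h using 2 with q
  exact (has_2 hf q.1 q.2.1 q.2.2).deriv

lemma tsmooth.contx {f : TField} (hf : tsmooth f) (t : ℝ) :
    Continuous (fun q : ℝ × ℝ => f t q.1 q.2) :=
  hf.cont.comp (f := fun q : ℝ × ℝ => (t, q.1, q.2)) (by fun_prop)

lemma d1_per {f : TField} (Γ : ℝ) (hp : tperiodic Γ f) : tperiodic Γ (d1 f) := by
  intro t x y
  unfold d1
  rw [← deriv_comp_add_const]
  congr 1
  ext z
  exact hp t z y

/-! Integral lemmas -/

lemma intΩ_eq {Γ : ℝ} (hΓ : 0 < Γ) (g : SField) :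
    intΩ Γ g = ∫ x in (0:ℝ)..Γ, ∫ y in (0:ℝ)..1, g x y := by
  unfold intΩ
  rw [intervalIntegral.integral_of_le hΓ.le]
  congr 1
  ext x
  rw [intervalIntegral.integral_of_le zero_le_one]

lemma cont_inner {g : SField} (hg : Continuous (fun q : ℝ × ℝ => g q.1 q.2)) (a b : ℝ) :
    Continuous (fun x => ∫ y in a..b, g x y) :=
  intervalIntegral.continuous_parametric_intervalIntegral_of_continuous' (f := g) hg a b

lemma cont_right {g : SField} (hg : Continuous (fun q : ℝ × ℝ => g q.1 q.2)) (x : ℝ) :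
    Continuous (g x) := hg.comp (f := fun y => (x, y)) (by fun_prop)
lemma cont_left {g : SField} (hg : Continuous (fun q : ℝ × ℝ => g q.1 q.2)) (y : ℝ) :
    Continuous (fun x => g x y) := hg.comp (f := fun x => (x, y)) (by fun_prop)

lemma intΩ_swap {Γ : ℝ} (g : SField) (hg : Continuous (fun q : ℝ × ℝ => g q.1 q.2)) :
    intΩ Γ g = ∫ y in Ioc (0:ℝ) 1, ∫ x in Ioc (0:ℝ) Γ, g x y := by
  unfold intΩ
  apply integral_integral_swap
  rw [Measure.prod_restrict]
  apply IntegrableOn.mono_set (t := Icc (0:ℝ) Γ ×ˢ Icc (0:ℝ) 1)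
  · exact (hg.continuousOn).integrableOn_compact (isCompact_Icc.prod isCompact_Icc)
  · exact Set.prod_mono Ioc_subset_Icc_self Ioc_subset_Icc_self

lemma intΩ_add {Γ : ℝ} (hΓ : 0 < Γ) {f g : SField} (hf : Continuous (fun q : ℝ × ℝ => f q.1 q.2))
    (hg : Continuous (fun q : ℝ × ℝ => g q.1 q.2)) :
    intΩ Γ (fun x y => f x y + g x y) = intΩ Γ f + intΩ Γ g := by
  simp only [intΩ_eq hΓ]
  rw [← intervalIntegral.integral_add ((cont_inner hf 0 1).intervalIntegrable _ _)
    ((cont_inner hg 0 1).intervalIntegrable _ _)]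
  congr 1
  ext x
  rw [← intervalIntegral.integral_add ((cont_right hf x).intervalIntegrable _ _)
    ((cont_right hg x).intervalIntegrable _ _)]

lemma intΩ_smul {Γ : ℝ} (hΓ : 0 < Γ) (c : ℝ) (f : SField) :
    intΩ Γ (fun x y => c * f x y) = c * intΩ Γ f := by
  simp only [intΩ_eq hΓ, intervalIntegral.integral_const_mul]

lemma intΩ_const {Γ : ℝ} (hΓ : 0 < Γ) (c : ℝ) : intΩ Γ (fun _ _ => c) = Γ * c := by
  simp [intΩ_eq hΓ]

lemma intΩ_congr {Γ : ℝ} {f g : SField}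
    (h : ∀ x, ∀ y ∈ Icc (0:ℝ) 1, f x y = g x y) : intΩ Γ f = intΩ Γ g := by
  unfold intΩ
  congr 1
  ext x
  exact setIntegral_congr_fun measurableSet_Ioc (fun y hy => h x y (Ioc_subset_Icc_self hy))

lemma intΩ_mono {Γ : ℝ} (hΓ : 0 < Γ) {f g : SField}
    (hf : Continuous (fun q : ℝ × ℝ => f q.1 q.2))
    (hg : Continuous (fun q : ℝ × ℝ => g q.1 q.2))
    (h : ∀ x, ∀ y ∈ Icc (0:ℝ) 1, f x y ≤ g x y) : intΩ Γ f ≤ intΩ Γ g := by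
  simp only [intΩ_eq hΓ]
  apply intervalIntegral.integral_mono_on hΓ.le ((cont_inner hf 0 1).intervalIntegrable _ _)
    ((cont_inner hg 0 1).intervalIntegrable _ _)
  intro x _
  exact intervalIntegral.integral_mono_on zero_le_one ((cont_right hf x).intervalIntegrable _ _)
    ((cont_right hg x).intervalIntegrable _ _) (h x)

lemma int_d1 {Γ : ℝ} (hΓ : 0 < Γ) {A A' : SField}
    (hA' : Continuous (fun q : ℝ × ℝ => A' q.1 q.2))
    (hd : ∀ x y, HasDerivAt (fun r => A r y) (A' x y) x)
    (hp : ∀ y, A Γ y = A 0 y) : intΩ Γ A' = 0 := by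
  rw [intΩ_swap _ hA']
  have : ∀ y, ∫ x in Ioc (0:ℝ) Γ, A' x y = 0 := by
    intro y
    rw [← intervalIntegral.integral_of_le hΓ.le,
      intervalIntegral.integral_eq_sub_of_hasDerivAt (f := fun r => A r y) (fun x _ => hd x y)
        ((cont_left hA' y).intervalIntegrable _ _), hp, sub_self]
  simp [this]

lemma int_d2 {Γ : ℝ} (hΓ : 0 < Γ) {B B' : SField}
    (hB' : Continuous (fun q : ℝ × ℝ => B' q.1 q.2))
    (hd : ∀ x y, HasDerivAt (fun r => B x r) (B' x y) y) :
    intΩ Γ B' = ∫ x in (0:ℝ)..Γ, (B x 1 - B x 0) := by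
  rw [intΩ_eq hΓ]
  congr 1
  ext x
  exact intervalIntegral.integral_eq_sub_of_hasDerivAt (fun y _ => hd x y)
    ((cont_right hB' x).intervalIntegrable _ _)

lemma deriv_under {F F' : SField} (a b : ℝ) (hF : Continuous (fun q : ℝ × ℝ => F q.1 q.2))
    (hF' : Continuous (fun q : ℝ × ℝ => F' q.1 q.2))
    (hd : ∀ s y, HasDerivAt (fun r => F r y) (F' s y) s) (s : ℝ) :
    HasDerivAt (fun r => ∫ y in a..b, F r y) (∫ y in a..b, F' s y) s := by
  obtain ⟨M, hM⟩ := ((isCompact_Icc (a := s - 1) (b := s + 1)).prod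
    (isCompact_uIcc (a := a) (b := b))).exists_bound_of_continuousOn hF'.continuousOn
  refine (intervalIntegral.hasDerivAt_integral_of_dominated_loc_of_deriv_le (F' := F')
    (bound := fun _ => M) (Icc_mem_nhds (a := s - 1) (b := s + 1) (by linarith) (by linarith))
    (Eventually.of_forall fun r => (cont_right hF r).aestronglyMeasurable)
    ((cont_right hF s).intervalIntegrable _ _) (cont_right hF' s).aestronglyMeasurable
    (Eventually.of_forall fun y hy r hr => hM (r, y) ⟨hr, uIoc_subset_uIcc hy⟩)
    (by simp) (Eventually.of_forall fun y _ r _ => hd r y)).2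

lemma deriv_intΩ {Γ : ℝ} (hΓ : 0 < Γ) {F F' : TField}
    (hF : Continuous (fun q : ℝ × ℝ × ℝ => F q.1 q.2.1 q.2.2))
    (hF' : Continuous (fun q : ℝ × ℝ × ℝ => F' q.1 q.2.1 q.2.2))
    (hd : ∀ s x y, HasDerivAt (fun r => F r x y) (F' s x y) s) (s : ℝ) :
    HasDerivAt (fun r => intΩ Γ (F r)) (intΩ Γ (F' s)) s := by
  simp only [intΩ_eq hΓ]
  have key : ∀ G : TField, Continuous (fun q : ℝ × ℝ × ℝ => G q.1 q.2.1 q.2.2) →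
      Continuous (fun q : ℝ × ℝ => ∫ y in (0:ℝ)..1, G q.1 q.2 y) := by
    intro G hG
    apply intervalIntegral.continuous_parametric_intervalIntegral_of_continuous'
      (f := fun (q : ℝ × ℝ) y => G q.1 q.2 y)
    exact hG.comp (f := fun z : (ℝ × ℝ) × ℝ => (z.1.1, z.1.2, z.2)) (by fun_prop)
  apply deriv_under (F := fun r x => ∫ y in (0:ℝ)..1, F r x y)
    (F' := fun r x => ∫ y in (0:ℝ)..1, F' r x y) 0 Γ (key F hF) (key F' hF')
  intro s x
  apply deriv_under (F := fun r y => F r x y) (F' := fun r y => F' r x y)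
  · exact hF.comp (f := fun z : ℝ × ℝ => (z.1, x, z.2)) (by fun_prop)
  · exact hF'.comp (f := fun z : ℝ × ℝ => (z.1, x, z.2)) (by fun_prop)
  · intro s y
    exact hd s x y

/-! Maximum principle -/

lemma second_le {g : ℝ → ℝ} {x : ℝ} (hm : IsLocalMax g x) (hc : ContinuousAt g x) :
    deriv (deriv g) x ≤ 0 := by
  by_contra! h
  have hmin := isLocalMin_of_deriv_deriv_pos h hm.deriv_eq_zero hc
  have heq : g =ᶠ[nhds x] fun _ => g x := by
    filter_upwards [hm, hmin] with y h1 h2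
    exact le_antisymm h1 h2
  have h1 : deriv g =ᶠ[nhds x] fun _ => 0 := by
    filter_upwards [heq.eventuallyEq_nhds] with y hy
    rw [hy.deriv_eq]; simp
  have h2 := h1.deriv_eq
  simp at h2
  linarith

lemma max_principle {Γ : ℝ} (hΓ : 0 < Γ) {f b1 b2 : TField} (hf : tsmooth f)
    (hp : tperiodic Γ f) (M : ℝ)
    (heq : ∀ t x y, 0 ≤ t → y ∈ Icc (0:ℝ) 1 →
      dt f t x y + b1 t x y * d1 f t x y + b2 t x y * d2 f t x y
        - (d1 (d1 f) t x y + d2 (d2 f) t x y) = 0)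
    (h0 : ∀ x y, y ∈ Icc (0:ℝ) 1 → f 0 x y ≤ M)
    (hb : ∀ t x, 0 ≤ t → f t x 0 ≤ M) (ht : ∀ t x, 0 ≤ t → f t x 1 ≤ M) :
    ∀ t x y, 0 ≤ t → y ∈ Icc (0:ℝ) 1 → f t x y ≤ M := by
  intro τ x y hτ hy
  by_contra! hlt
  set ε := (f τ x y - M) / (2 * (τ + 1)) with hε
  have hτ1 : 0 < 2 * (τ + 1) := by linarith
  have hε0 : 0 < ε := div_pos (by linarith) hτ1
  have hε1 : ε * (2 * (τ + 1)) = f τ x y - M := by rw [hε]; field_simp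
  have hcont : ContinuousOn (fun q : ℝ × ℝ × ℝ => f q.1 q.2.1 q.2.2 - ε * q.1)
      (Icc 0 τ ×ˢ Icc 0 Γ ×ˢ Icc 0 1) := by
    apply Continuous.continuousOn
    exact hf.cont.sub (by fun_prop)
  obtain ⟨⟨t0, x0, y0⟩, ⟨ht0, hx0, hy0⟩, hmax⟩ :=
    (isCompact_Icc.prod (isCompact_Icc.prod isCompact_Icc)).exists_isMaxOn
      ⟨(0, 0, 0), by simp [hτ, hΓ.le]⟩ hcont
  simp only at ht0 hx0 hy0
  have hmax' : ∀ t x y, t ∈ Icc 0 τ → y ∈ Icc (0:ℝ) 1 →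
      f t x y - ε * t ≤ f t0 x0 y0 - ε * t0 := by
    intro t x y ht hy
    have hper : Function.Periodic (fun x => f t x y) Γ := fun x => hp t x y
    obtain ⟨x', hx', hxe⟩ := hper.exists_mem_Ico₀ hΓ x
    have : f t x' y - ε * t ≤ f t0 x0 y0 - ε * t0 := hmax (show (t, x', y) ∈ Icc (0:ℝ) τ ×ˢ Icc (0:ℝ) Γ ×ˢ Icc (0:ℝ) 1 from
      ⟨ht, Ico_subset_Icc_self hx', hy⟩)
    have hxe' : f t x y = f t x' y := hxe
    rw [hxe']
    exact this
  have hbig : M < f t0 x0 y0 - ε * t0 := by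
    have := hmax' τ x y ⟨hτ, le_rfl⟩ hy
    nlinarith
  have hεt : 0 ≤ ε * t0 := mul_nonneg hε0.le ht0.1
  have ht0' : 0 < t0 := by
    rcases ht0.1.eq_or_lt with h | h
    · have := h0 x0 y0 hy0
      rw [h] at this; linarith
    · exact h
  have hy0' : y0 ∈ Ioo (0:ℝ) 1 := by
    constructor
    · rcases hy0.1.eq_or_lt with h | h
      · have := hb t0 x0 ht0.1
        rw [h] at this; linarith
      · exact h
    · rcases hy0.2.eq_or_lt with h | h
      · have := ht t0 x0 ht0.1
        rw [← h] at this; linarith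
      · exact h
  have m1 : IsLocalMax (fun r => f t0 r y0) x0 := by
    apply Eventually.of_forall
    intro r
    have := hmax' t0 r y0 ht0 hy0
    simp only; linarith
  have m2 : IsLocalMax (fun r => f t0 x0 r) y0 := by
    filter_upwards [Icc_mem_nhds hy0'.1 hy0'.2] with r hr
    have := hmax' t0 x0 r ht0 hr
    linarith
  have e1 : d1 f t0 x0 y0 = 0 := m1.deriv_eq_zero
  have e2 : d2 f t0 x0 y0 = 0 := m2.deriv_eq_zero
  have s1 : d1 (d1 f) t0 x0 y0 ≤ 0 := second_le m1 (hf.hd1 t0 x0 y0).continuousAt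
  have s2 : d2 (d2 f) t0 x0 y0 ≤ 0 := second_le m2 (hf.hd2 t0 x0 y0).continuousAt
  have et : ε ≤ dt f t0 x0 y0 := by
    have hd : HasDerivAt (fun r => f r x0 y0 - ε * r) (dt f t0 x0 y0 - ε * 1) t0 :=
      (hf.hdt t0 x0 y0).sub ((hasDerivAt_id t0).const_mul ε)
    have hlim := hd.tendsto_slope.mono_left
      (nhdsWithin_mono t0 (show Iio t0 ⊆ {t0}ᶜ from fun z hz => ne_of_lt hz))
    have : 0 ≤ dt f t0 x0 y0 - ε * 1 := by
      apply ge_of_tendsto hlim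
      filter_upwards [Ioo_mem_nhdsLT ht0'] with r hr
      rw [slope_def_field]
      apply div_nonneg_of_nonpos
      · have := hmax' r x0 y0 ⟨hr.1.le, hr.2.le.trans ht0.2⟩ hy0
        linarith
      · linarith [hr.2]
    linarith
  have := heq t0 x0 y0 ht0.1 hy0
  rw [e1, e2] at this
  linarith

/-! One-dimensional inequalities -/

lemma osc {f f' : ℝ → ℝ} (hd : ∀ x, HasDerivAt f (f' x) x) (hc : Continuous f') {a x : ℝ}
    (ha : a ∈ Icc (0:ℝ) 1) (hx : x ∈ Icc (0:ℝ) 1) :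
    (f x - f a) ^ 2 ≤ ∫ y in (0:ℝ)..1, f' y ^ 2 := by
  have h1 : ∫ y in a..x, f' y = f x - f a :=
    intervalIntegral.integral_eq_sub_of_hasDerivAt (fun y _ => hd y) (hc.intervalIntegrable _ _)
  set l := ∫ y in (0:ℝ)..1, |f' y| with hl
  have h2 : |f x - f a| ≤ l := by
    rw [← h1]
    refine (intervalIntegral.norm_integral_le_integral_norm_uIoc (f := f') (μ := volume)).trans ?_
    rw [hl, intervalIntegral.integral_of_le zero_le_one]
    apply setIntegral_mono_set
    · exact (hc.abs.intervalIntegrable 0 1).1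
    · exact Eventually.of_forall fun y => abs_nonneg _
    · apply LE.le.eventuallyLE
      rw [uIoc]
      exact Ioc_subset_Ioc (le_min ha.1 hx.1) (max_le ha.2 hx.2)
  have hc2 : Continuous fun y => f' y ^ 2 := hc.pow 2
  have h3 : ∫ y in (0:ℝ)..1, (2 * l) * |f' y| ≤ ∫ y in (0:ℝ)..1, (f' y ^ 2 + l ^ 2) := by
    apply intervalIntegral.integral_mono_on zero_le_one
    · exact (hc.abs.const_mul _).intervalIntegrable _ _
    · exact (hc2.add continuous_const).intervalIntegrable _ _
    · intro y _
      nlinarith [sq_nonneg (|f' y| - l), sq_abs (f' y)]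
  rw [intervalIntegral.integral_const_mul, intervalIntegral.integral_add
    (hc2.intervalIntegrable _ _) (by simp), ← hl] at h3
  simp at h3
  have : (f x - f a) ^ 2 ≤ l ^ 2 := by
    rw [← sq_abs (f x - f a)]
    exact pow_le_pow_left₀ (abs_nonneg _) h2 2
  nlinarith

lemma ode_bound {y y' : ℝ → ℝ} {c B : ℝ} (hc : 0 < c) (hd : ∀ t, HasDerivAt y (y' t) t)
    (h : ∀ t, 0 ≤ t → y' t ≤ c * (B - y t)) (t : ℝ) (ht : 0 ≤ t) : y t ≤ max (y 0) B := by
  apply le_of_forall_pos_le_add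
  intro ε hε
  refine image_le_of_deriv_right_lt_deriv_boundary (f := y) (f' := y') (a := 0) (b := t)
    (B := fun _ => max (y 0) B + ε) (B' := fun _ => 0)
    (fun x _ => (hd x).continuousAt.continuousWithinAt) (fun x _ => (hd x).hasDerivWithinAt)
    (by linarith [le_max_left (y 0) B]) (fun x => hasDerivAt_const _ _) ?_ ⟨ht, le_rfl⟩
  intro x hx he
  have := h x hx.1
  have h2 := le_max_right (y 0) B
  rw [he] at this
  nlinarith

/-! Energy -/

lemma T_bound {Γ Ra Pr : ℝ} {Ls : ℝ≥0∞} (hΓ : 0 < Γ) (S : Sol Γ Ra Pr Ls) (h0 : T0cond S)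
    (t x y : ℝ) (ht : 0 ≤ t) (hy : y ∈ Icc (0:ℝ) 1) : S.T t x y ^ 2 ≤ 1 := by
  have up := max_principle hΓ S.smooth_T S.periodic_T 1 S.heat (fun x y hy => (h0 x y hy).2)
    (fun t x ht => (S.T_bot t x ht).le) (fun t x ht => by rw [S.T_top t x ht]; norm_num)
    t x y ht hy
  let f : TField := fun t x y => -S.T t x y
  have hf : tsmooth f := ContDiff.neg S.smooth_T
  have e1 : d1 f = fun t x y => -d1 S.T t x y := by
    funext t x y; exact (S.smooth_T.hd1 t x y).neg.deriv
  have e2 : d2 f = fun t x y => -d2 S.T t x y := by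
    funext t x y; exact (S.smooth_T.hd2 t x y).neg.deriv
  have e3 : dt f = fun t x y => -dt S.T t x y := by
    funext t x y; exact (S.smooth_T.hdt t x y).neg.deriv
  have e11 : d1 (d1 f) = fun t x y => -d1 (d1 S.T) t x y := by
    rw [e1]; funext t x y; exact (S.smooth_T.d1.hd1 t x y).neg.deriv
  have e22 : d2 (d2 f) = fun t x y => -d2 (d2 S.T) t x y := by
    rw [e2]; funext t x y; exact (S.smooth_T.d2.hd2 t x y).neg.deriv
  have lo := max_principle hΓ (f := f) (b1 := S.u1) (b2 := S.u2) hf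
    (fun t x y => by simp only [f, S.periodic_T t x y]) 0
    (fun t x y ht hy => by
      rw [e11, e22, e1, e2, e3]
      linear_combination -(S.heat t x y ht hy))
    (fun x y hy => by simp only [f]; linarith [(h0 x y hy).1])
    (fun t x ht => by simp only [f, S.T_bot t x ht]; norm_num)
    (fun t x ht => by simp only [f, S.T_top t x ht]; norm_num) t x y ht hy
  simp only [f] at lo
  nlinarith

/-- The kinetic energy. -/
def en {Γ Ra Pr : ℝ} {Ls : ℝ≥0∞} (S : Sol Γ Ra Pr Ls) (t : ℝ) : ℝ :=
  intΩ Γ (fun x y => S.u1 t x y ^ 2 + S.u2 t x y ^ 2)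

def en' {Γ Ra Pr : ℝ} {Ls : ℝ≥0∞} (S : Sol Γ Ra Pr Ls) (t : ℝ) : ℝ :=
  intΩ Γ (fun x y => 2 * S.u1 t x y * dt S.u1 t x y + 2 * S.u2 t x y * dt S.u2 t x y)

lemma en_deriv {Γ Ra Pr : ℝ} {Ls : ℝ≥0∞} (hΓ : 0 < Γ) (S : Sol Γ Ra Pr Ls) (t : ℝ) :
    HasDerivAt (en S) (en' S t) t := by
  have c1 := S.smooth_u1.cont
  have c2 := S.smooth_u2.cont
  have c3 := S.smooth_u1.dt.cont
  have c4 := S.smooth_u2.dt.cont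
  refine deriv_intΩ hΓ (F := fun t x y => S.u1 t x y ^ 2 + S.u2 t x y ^ 2)
    (F' := fun t x y => 2 * S.u1 t x y * dt S.u1 t x y + 2 * S.u2 t x y * dt S.u2 t x y)
    ?_ ?_ ?_ t
  · exact (c1.pow 2).add (c2.pow 2)
  · exact ((continuous_const.mul c1).mul c3).add ((continuous_const.mul c2).mul c4)
  · intro s x y
    exact (((S.smooth_u1.hdt s x y).pow 2).add ((S.smooth_u2.hdt s x y).pow 2)).congr_deriv
      (by simp)

lemma gradSq_cont {Γ Ra Pr : ℝ} {Ls : ℝ≥0∞} (S : Sol Γ Ra Pr Ls) (t : ℝ) :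
    Continuous (fun q : ℝ × ℝ => gradSq S t q.1 q.2) :=
  ((((S.smooth_u1.d1.contx t).pow 2).add ((S.smooth_u1.d2.contx t).pow 2)).add
    ((S.smooth_u2.d1.contx t).pow 2)).add ((S.smooth_u2.d2.contx t).pow 2)

lemma energy_identity {Γ Ra Pr : ℝ} {Ls : ℝ≥0∞} (hΓ : 0 < Γ) (hPr : 0 < Pr)
    (S : Sol Γ Ra Pr Ls) (t : ℝ) (ht : 0 ≤ t) :
    en' S t = Pr * (intΩ Γ (fun x y => 2 * Ra * S.T t x y * S.u2 t x y)
      - 2 * intΩ Γ (gradSq S t)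
      - 2 * ((Ls⁻¹).toReal * ∫ x in (0:ℝ)..Γ, (S.u1 t x 1 ^ 2 + S.u1 t x 0 ^ 2))) := by
  set r := Pr⁻¹ with hr
  have hr1 : Pr * r = 1 := mul_inv_cancel₀ hPr.ne'
  have s1 := S.smooth_u1
  have s2 := S.smooth_u2
  have sp := S.smooth_p
  have c1 := s1.contx t
  have c2 := s2.contx t
  have cp := sp.contx t
  have cT := S.smooth_T.contx t
  have c11 := s1.d1.contx t
  have c12 := s1.d2.contx t
  have c21 := s2.d1.contx t
  have c22 := s2.d2.contx t
  have cp1 := sp.d1.contx t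
  have cp2 := sp.d2.contx t
  have c111 := s1.d1.d1.contx t
  have c122 := s1.d2.d2.contx t
  have c211 := s2.d1.d1.contx t
  have c222 := s2.d2.d2.contx t
  let A : SField := fun x y => S.u1 t x y * d1 S.u1 t x y + S.u2 t x y * d1 S.u2 t x y
    - S.p t x y * S.u1 t x y - r * (1 / 2) * (S.u1 t x y * (S.u1 t x y ^ 2 + S.u2 t x y ^ 2))
  let B : SField := fun x y => S.u1 t x y * d2 S.u1 t x y + S.u2 t x y * d2 S.u2 t x y
    - S.p t x y * S.u2 t x y - r * (1 / 2) * (S.u2 t x y * (S.u1 t x y ^ 2 + S.u2 t x y ^ 2))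
  let A' : SField := fun x y =>
    (d1 S.u1 t x y * d1 S.u1 t x y + S.u1 t x y * d1 (d1 S.u1) t x y)
    + (d1 S.u2 t x y * d1 S.u2 t x y + S.u2 t x y * d1 (d1 S.u2) t x y)
    - (d1 S.p t x y * S.u1 t x y + S.p t x y * d1 S.u1 t x y)
    - r * (1 / 2) * (d1 S.u1 t x y * (S.u1 t x y ^ 2 + S.u2 t x y ^ 2)
      + S.u1 t x y * (2 * S.u1 t x y * d1 S.u1 t x y + 2 * S.u2 t x y * d1 S.u2 t x y))
  let B' : SField := fun x y =>
    (d2 S.u1 t x y * d2 S.u1 t x y + S.u1 t x y * d2 (d2 S.u1) t x y)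
    + (d2 S.u2 t x y * d2 S.u2 t x y + S.u2 t x y * d2 (d2 S.u2) t x y)
    - (d2 S.p t x y * S.u2 t x y + S.p t x y * d2 S.u2 t x y)
    - r * (1 / 2) * (d2 S.u2 t x y * (S.u1 t x y ^ 2 + S.u2 t x y ^ 2)
      + S.u2 t x y * (2 * S.u1 t x y * d2 S.u1 t x y + 2 * S.u2 t x y * d2 S.u2 t x y))
  have cA : Continuous (fun q : ℝ × ℝ => A' q.1 q.2) := by
    simp only [A']
    apply_rules [Continuous.add, Continuous.sub, Continuous.neg, Continuous.mul,
      Continuous.pow, continuous_const]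
    all_goals apply_rules [Continuous.add, Continuous.sub, Continuous.neg, Continuous.mul,
      Continuous.pow, continuous_const]
  have cB : Continuous (fun q : ℝ × ℝ => B' q.1 q.2) := by
    simp only [B']
    apply_rules [Continuous.add, Continuous.sub, Continuous.neg, Continuous.mul,
      Continuous.pow, continuous_const]
    all_goals apply_rules [Continuous.add, Continuous.sub, Continuous.neg, Continuous.mul,
      Continuous.pow, continuous_const]
  have hA : intΩ Γ A' = 0 := by
    apply int_d1 hΓ (A := A) cA
    · intro x y
      have a1 := s1.hd1 t x y
      have a2 := s2.hd1 t x y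
      have a3 := sp.hd1 t x y
      have a4 := s1.d1.hd1 t x y
      have a5 := s2.d1.hd1 t x y
      exact ((((a1.mul a4).add (a2.mul a5)).sub (a3.mul a1)).sub
        ((a1.mul ((a1.pow 2).add (a2.pow 2))).const_mul (r * (1 / 2)))).congr_deriv
        (by simp [A'])
    · intro y
      have h : ∀ f : TField, tperiodic Γ f → f t Γ y = f t 0 y := by
        intro f hf
        have := hf t 0 y
        rwa [zero_add] at this
      simp only [A, h _ S.periodic_u1, h _ S.periodic_u2, h _ S.periodic_p,
        h _ (d1_per Γ S.periodic_u1), h _ (d1_per Γ S.periodic_u2)]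
  have hB : intΩ Γ B' = -((Ls⁻¹).toReal * ∫ x in (0:ℝ)..Γ, (S.u1 t x 1 ^ 2 + S.u1 t x 0 ^ 2)) := by
    rw [int_d2 hΓ (B := B) cB, ← intervalIntegral.integral_const_mul,
      ← intervalIntegral.integral_neg]
    · congr 1
      ext x
      simp only [B, S.u2_bot t x ht, S.u2_top t x ht, S.slip_top t x ht, S.slip_bot t x ht]
      ring
    · intro x y
      have a1 := s1.hd2 t x y
      have a2 := s2.hd2 t x y
      have a3 := sp.hd2 t x y
      have a4 := s1.d2.hd2 t x y
      have a5 := s2.d2.hd2 t x y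
      exact ((((a1.mul a4).add (a2.mul a5)).sub (a3.mul a2)).sub
        ((a2.mul ((a1.pow 2).add (a2.pow 2))).const_mul (r * (1 / 2)))).congr_deriv
        (by simp [B'])
  have cG := gradSq_cont S t
  have cTu : Continuous (fun q : ℝ × ℝ => 2 * Ra * S.T t q.1 q.2 * S.u2 t q.1 q.2) := by
    apply_rules [Continuous.mul, continuous_const]
  have pt : en' S t = intΩ Γ (fun x y => Pr * ((2 * Ra * S.T t x y * S.u2 t x y
      + (-2) * gradSq S t x y) + (2 * A' x y + 2 * B' x y))) := by
    unfold en'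
    apply intΩ_congr
    intro x y hy
    have m1 := S.momentum1 t x y ht hy
    have m2 := S.momentum2 t x y ht hy
    have inc := S.incomp t x y ht hy
    rw [← hr] at m1 m2
    simp only [A', B', gradSq]
    linear_combination (2 * Pr * S.u1 t x y) * m1 + (2 * Pr * S.u2 t x y) * m2
      + (2 * Pr * S.p t x y + Pr * r * (S.u1 t x y ^ 2 + S.u2 t x y ^ 2)) * inc
      - 2 * (S.u1 t x y * dt S.u1 t x y + S.u2 t x y * dt S.u2 t x y) * hr1
  rw [pt, intΩ_smul hΓ, intΩ_add hΓ (cTu.add (continuous_const.mul cG))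
    ((continuous_const.mul cA).add (continuous_const.mul cB)),
    intΩ_add hΓ cTu (continuous_const.mul cG),
    intΩ_add hΓ (continuous_const.mul cA) (continuous_const.mul cB),
    intΩ_smul hΓ, intΩ_smul hΓ, intΩ_smul hΓ, hA, hB]
  ring

lemma energy_general {Γ Ra Pr : ℝ} {Ls : ℝ≥0∞} (hΓ : 0 < Γ) (hRa : 0 < Ra) (hPr : 0 < Pr)
    (S : Sol Γ Ra Pr Ls) (h0 : T0cond S) (K : ℝ) (hK : 0 < K)
    (hco : ∀ t, 0 ≤ t → en S t ≤ K * (intΩ Γ (gradSq S t)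
      + (Ls⁻¹).toReal * ∫ x in (0:ℝ)..Γ, (S.u1 t x 1 ^ 2 + S.u1 t x 0 ^ 2)))
    (t : ℝ) (ht : 0 ≤ t) : uL2 S t ≤ uL2 S 0 + K * √Γ * Ra := by
  have key : en S t ≤ max (en S 0) (K ^ 2 * Ra ^ 2 * Γ) := by
    apply ode_bound (c := Pr / K) (by positivity) (en_deriv hΓ S) ?_ t ht
    intro t ht
    have hi := energy_identity hΓ hPr S t ht
    have hc := hco t ht
    set D := intΩ Γ (gradSq S t)
      + (Ls⁻¹).toReal * ∫ x in (0:ℝ)..Γ, (S.u1 t x 1 ^ 2 + S.u1 t x 0 ^ 2) with hD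
    have c1 := S.smooth_u1.contx t
    have c2 := S.smooth_u2.contx t
    have cT := S.smooth_T.contx t
    have cen : Continuous (fun q : ℝ × ℝ => S.u1 t q.1 q.2 ^ 2 + S.u2 t q.1 q.2 ^ 2) :=
      (c1.pow 2).add (c2.pow 2)
    have hT : intΩ Γ (fun x y => 2 * Ra * S.T t x y * S.u2 t x y)
        ≤ K⁻¹ * en S t + Γ * (K * Ra ^ 2) := by
      unfold en
      rw [← intΩ_const hΓ, ← intΩ_smul hΓ, ← intΩ_add hΓ (continuous_const.mul cen)
        continuous_const]
      apply intΩ_mono hΓ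
      · exact (continuous_const.mul cT).mul c2
      · exact (continuous_const.mul cen).add continuous_const
      · intro x y hy
        have hb := T_bound hΓ S h0 t x y ht hy
        have e : K⁻¹ * (S.u2 t x y - K * Ra * S.T t x y) ^ 2 = K⁻¹ * S.u2 t x y ^ 2
            - 2 * Ra * S.T t x y * S.u2 t x y + K * Ra ^ 2 * S.T t x y ^ 2 := by
          field_simp; ring
        have p1 : 0 ≤ K⁻¹ * (S.u2 t x y - K * Ra * S.T t x y) ^ 2 := by positivity
        have p2 : 0 ≤ K⁻¹ * S.u1 t x y ^ 2 := by positivity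
        have p3 : K * Ra ^ 2 * S.T t x y ^ 2 ≤ K * Ra ^ 2 * 1 :=
          mul_le_mul_of_nonneg_left hb (by positivity)
        linarith
    have hc' : K⁻¹ * en S t ≤ D := by
      rw [inv_mul_le_iff₀ hK]; exact hc
    calc en' S t ≤ Pr * (-(K⁻¹ * en S t) + Γ * (K * Ra ^ 2)) := by
          rw [hi]
          apply mul_le_mul_of_nonneg_left _ hPr.le
          linarith
      _ = Pr / K * (K ^ 2 * Ra ^ 2 * Γ - en S t) := by field_simp; ring
  have e1 : uL2 S t = √(en S t) := rfl
  have e2 : uL2 S 0 = √(en S 0) := rfl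
  have e3 : K * √Γ * Ra = √(K ^ 2 * Ra ^ 2 * Γ) := by
    rw [show K ^ 2 * Ra ^ 2 * Γ = (K * Ra) ^ 2 * Γ by ring, Real.sqrt_mul (by positivity),
      Real.sqrt_sq (by positivity)]
    ring
  rw [e1, e2, e3]
  refine (Real.sqrt_le_sqrt key).trans ?_
  rcases max_cases (en S 0) (K ^ 2 * Ra ^ 2 * Γ) with h | h <;> rw [h.1] <;>
    linarith [Real.sqrt_nonneg (en S 0), Real.sqrt_nonneg (K ^ 2 * Ra ^ 2 * Γ)]

/-! Coercivity -/

lemma poinc {Γ : ℝ} (hΓ : 0 < Γ) {f : TField} (hf : tsmooth f) (t : ℝ) {a : ℝ → ℝ}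
    (ha : Continuous a) (k : ℝ)
    (h : ∀ x, ∀ y ∈ Icc (0:ℝ) 1, f t x y ^ 2 ≤ a x + k * ∫ z in (0:ℝ)..1, d2 f t x z ^ 2) :
    intΩ Γ (fun x y => f t x y ^ 2)
      ≤ (∫ x in (0:ℝ)..Γ, a x) + k * intΩ Γ (fun x y => d2 f t x y ^ 2) := by
  have c : Continuous (fun q : ℝ × ℝ => f t q.1 q.2 ^ 2) := (hf.contx t).pow 2
  have c' : Continuous (fun q : ℝ × ℝ => d2 f t q.1 q.2 ^ 2) := (hf.d2.contx t).pow 2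
  have ci := cont_inner (g := fun x y => d2 f t x y ^ 2) c' 0 1
  have ck : Continuous (fun x => k * ∫ y in (0:ℝ)..1, d2 f t x y ^ 2) := continuous_const.mul ci
  simp only [intΩ_eq hΓ]
  rw [← intervalIntegral.integral_const_mul, ← intervalIntegral.integral_add
    (ha.intervalIntegrable _ _) (ck.intervalIntegrable _ _)]
  apply intervalIntegral.integral_mono_on hΓ.le
    ((cont_inner (g := fun x y => f t x y ^ 2) c 0 1).intervalIntegrable _ _)
    ((ha.add ck).intervalIntegrable _ _)
  intro x _
  have := intervalIntegral.integral_mono_on zero_le_one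
    ((cont_right (g := fun x y => f t x y ^ 2) c x).intervalIntegrable 0 1)
    (intervalIntegrable_const (μ := volume)) (h x)
  simpa using this

lemma poinc_u2 {Γ Ra Pr : ℝ} {Ls : ℝ≥0∞} (hΓ : 0 < Γ)
    (S : Sol Γ Ra Pr Ls) (t : ℝ) (ht : 0 ≤ t) :
    intΩ Γ (fun x y => S.u2 t x y ^ 2) ≤ intΩ Γ (fun x y => d2 S.u2 t x y ^ 2) := by
  have := poinc hΓ S.smooth_u2 t (a := fun _ => 0) continuous_const 1 (by
    intro x y hy
    have := osc (fun y => S.smooth_u2.hd2 t x y) (cont_right (S.smooth_u2.d2.contx t) x)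
      (a := 0) (by simp) hy
    rw [S.u2_bot t x ht, sub_zero] at this
    linarith)
  simpa using this

lemma en_split {Γ Ra Pr : ℝ} {Ls : ℝ≥0∞} (hΓ : 0 < Γ) (S : Sol Γ Ra Pr Ls) (t : ℝ) :
    en S t = intΩ Γ (fun x y => S.u1 t x y ^ 2) + intΩ Γ (fun x y => S.u2 t x y ^ 2) := by
  unfold en
  exact intΩ_add hΓ (f := fun x y => S.u1 t x y ^ 2) (g := fun x y => S.u2 t x y ^ 2)
    ((S.smooth_u1.contx t).pow 2) ((S.smooth_u2.contx t).pow 2)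

lemma grad_ge {Γ Ra Pr : ℝ} {Ls : ℝ≥0∞} (hΓ : 0 < Γ) (S : Sol Γ Ra Pr Ls) (t : ℝ) :
    intΩ Γ (fun x y => d2 S.u1 t x y ^ 2) + intΩ Γ (fun x y => d2 S.u2 t x y ^ 2)
      ≤ intΩ Γ (gradSq S t) := by
  have c1 := (S.smooth_u1.d2.contx t).pow 2
  have c2 := (S.smooth_u2.d2.contx t).pow 2
  rw [← intΩ_add hΓ (f := fun x y => d2 S.u1 t x y ^ 2) (g := fun x y => d2 S.u2 t x y ^ 2) c1 c2]
  apply intΩ_mono hΓ (c1.add c2) (gradSq_cont S t)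
  intro x y _
  simp only [gradSq]
  nlinarith [sq_nonneg (d1 S.u1 t x y), sq_nonneg (d1 S.u2 t x y)]

lemma intΩ_sq_nonneg {Γ : ℝ} (f : SField) : 0 ≤ intΩ Γ (fun x y => f x y ^ 2) :=
  integral_nonneg fun _ => integral_nonneg fun _ => sq_nonneg _

lemma coercive_slip {Γ Ra Pr Ls : ℝ} (hΓ : 0 < Γ) (hLs : 0 < Ls)
    (S : Sol Γ Ra Pr (ENNReal.ofReal Ls)) (t : ℝ) (ht : 0 ≤ t) :
    en S t ≤ (2 * max 1 Ls) * (intΩ Γ (gradSq S t) + ((ENNReal.ofReal Ls)⁻¹).toReal *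
      ∫ x in (0:ℝ)..Γ, (S.u1 t x 1 ^ 2 + S.u1 t x 0 ^ 2)) := by
  have hβ : ((ENNReal.ofReal Ls)⁻¹).toReal = Ls⁻¹ := by
    rw [ENNReal.toReal_inv, ENNReal.toReal_ofReal hLs.le]
  rw [hβ]
  have cb0 : Continuous fun x => S.u1 t x 0 ^ 2 := (cont_left (S.smooth_u1.contx t) 0).pow 2
  have cb1 : Continuous fun x => S.u1 t x 1 ^ 2 := (cont_left (S.smooth_u1.contx t) 1).pow 2
  have h1 := poinc hΓ S.smooth_u1 t (a := fun x => 2 * S.u1 t x 0 ^ 2)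
    (continuous_const.mul cb0) 2 (by
    intro x y hy
    have := osc (fun y => S.smooth_u1.hd2 t x y) (cont_right (S.smooth_u1.d2.contx t) x)
      (a := 0) (by simp) hy
    nlinarith [sq_nonneg (S.u1 t x y - 2 * S.u1 t x 0)])
  rw [intervalIntegral.integral_const_mul] at h1
  have h2 := poinc_u2 hΓ S t ht
  have h3 := grad_ge hΓ S t
  have h4 := intΩ_sq_nonneg (Γ := Γ) (d2 S.u1 t)
  have h5 := intΩ_sq_nonneg (Γ := Γ) (d2 S.u2 t)
  have b0 : 0 ≤ ∫ x in (0:ℝ)..Γ, S.u1 t x 0 ^ 2 :=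
    intervalIntegral.integral_nonneg hΓ.le fun _ _ => sq_nonneg _
  have b1 : 0 ≤ ∫ x in (0:ℝ)..Γ, S.u1 t x 1 ^ 2 :=
    intervalIntegral.integral_nonneg hΓ.le fun _ _ => sq_nonneg _
  rw [en_split hΓ, intervalIntegral.integral_add (cb1.intervalIntegrable _ _)
    (cb0.intervalIntegrable _ _)]
  set m := max 1 Ls
  have hm1 : 1 ≤ m := le_max_left _ _
  have hm2 : 1 ≤ m * Ls⁻¹ := by
    rw [← div_eq_mul_inv, le_div_iff₀ hLs, one_mul]; exact le_max_right _ _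
  have k1 : intΩ Γ (gradSq S t) ≤ m * intΩ Γ (gradSq S t) :=
    le_mul_of_one_le_left (by linarith) hm1
  have k2 : ∫ x in (0:ℝ)..Γ, S.u1 t x 0 ^ 2 ≤ (m * Ls⁻¹) * ∫ x in (0:ℝ)..Γ, S.u1 t x 0 ^ 2 :=
    le_mul_of_one_le_left b0 hm2
  have k3 : 0 ≤ (m * Ls⁻¹) * ∫ x in (0:ℝ)..Γ, S.u1 t x 1 ^ 2 :=
    mul_nonneg (by linarith) b1
  linarith

lemma mean_conserved {Γ Ra Pr : ℝ} (hΓ : 0 < Γ) (hPr : 0 < Pr) (S : Sol Γ Ra Pr ⊤)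
    (t : ℝ) (ht : 0 ≤ t) : intΩ Γ (S.u1 t) = intΩ Γ (S.u1 0) := by
  have s1 := S.smooth_u1
  have s2 := S.smooth_u2
  have sp := S.smooth_p
  have hd : ∀ s, HasDerivAt (fun r => intΩ Γ (S.u1 r)) (intΩ Γ (dt S.u1 s)) s := fun s =>
    deriv_intΩ hΓ s1.cont s1.dt.cont s1.hdt s
  have hz : ∀ t, 0 ≤ t → intΩ Γ (dt S.u1 t) = 0 := by
    intro t ht
    have c1 := s1.contx t
    have c2 := s2.contx t
    have c11 := s1.d1.contx t
    have c12 := s1.d2.contx t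
    have c22 := s2.d2.contx t
    have cp1 := sp.d1.contx t
    have c111 := s1.d1.d1.contx t
    have c122 := s1.d2.d2.contx t
    let A : SField := fun x y => Pr * (d1 S.u1 t x y - S.p t x y) - S.u1 t x y * S.u1 t x y
    let A' : SField := fun x y => Pr * (d1 (d1 S.u1) t x y - d1 S.p t x y)
      - (d1 S.u1 t x y * S.u1 t x y + S.u1 t x y * d1 S.u1 t x y)
    let B : SField := fun x y => Pr * d2 S.u1 t x y - S.u1 t x y * S.u2 t x y
    let B' : SField := fun x y => Pr * d2 (d2 S.u1) t x y
      - (d2 S.u1 t x y * S.u2 t x y + S.u1 t x y * d2 S.u2 t x y)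
    have cA : Continuous (fun q : ℝ × ℝ => A' q.1 q.2) := by
      simp only [A']
      apply_rules [Continuous.add, Continuous.sub, Continuous.neg, Continuous.mul, continuous_const]
    have cB : Continuous (fun q : ℝ × ℝ => B' q.1 q.2) := by
      simp only [B']
      apply_rules [Continuous.add, Continuous.sub, Continuous.neg, Continuous.mul, continuous_const]
    have hA : intΩ Γ A' = 0 := by
      apply int_d1 hΓ (A := A) cA
      · intro x y
        exact (((s1.d1.hd1 t x y).sub (sp.hd1 t x y)).const_mul Pr).sub
          ((s1.hd1 t x y).mul (s1.hd1 t x y))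
      · intro y
        have h : ∀ f : TField, tperiodic Γ f → f t Γ y = f t 0 y := by
          intro f hf
          have := hf t 0 y
          rwa [zero_add] at this
        simp only [A, h _ S.periodic_u1, h _ S.periodic_p, h _ (d1_per Γ S.periodic_u1)]
    have hB : intΩ Γ B' = 0 := by
      rw [int_d2 hΓ (B := B) cB]
      · simp [B, S.u2_bot t _ ht, S.u2_top t _ ht, S.slip_top t _ ht, S.slip_bot t _ ht]
      · intro x y
        exact ((s1.d2.hd2 t x y).const_mul Pr).sub ((s1.hd2 t x y).mul (s2.hd2 t x y))
    have : intΩ Γ (dt S.u1 t) = intΩ Γ (fun x y => A' x y + B' x y) := by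
      apply intΩ_congr
      intro x y hy
      have m1 := S.momentum1 t x y ht hy
      have inc := S.incomp t x y ht hy
      have hr1 : Pr * Pr⁻¹ = 1 := mul_inv_cancel₀ hPr.ne'
      simp only [A', B']
      linear_combination Pr * m1 + S.u1 t x y * inc - (dt S.u1 t x y
        + S.u1 t x y * d1 S.u1 t x y + S.u2 t x y * d2 S.u1 t x y) * hr1
    rw [this, intΩ_add hΓ cA cB, hA, hB, add_zero]
  exact constant_of_has_deriv_right_zero (f := fun r => intΩ Γ (S.u1 r)) (a := 0) (b := t)
    (fun x _ => (hd x).continuousAt.continuousWithinAt)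
    (fun x hx => by rw [← hz x hx.1]; exact (hd x).hasDerivWithinAt) t ⟨ht, le_rfl⟩

lemma column_zero {Γ Ra Pr : ℝ} {Ls : ℝ≥0∞} (hΓ : 0 < Γ) (S : Sol Γ Ra Pr Ls)
    (t : ℝ) (ht : 0 ≤ t) (hm : intΩ Γ (S.u1 t) = 0) (x : ℝ) :
    ∫ y in (0:ℝ)..1, S.u1 t x y = 0 := by
  have hd : ∀ x, HasDerivAt (fun r => ∫ y in (0:ℝ)..1, S.u1 t r y) 0 x := by
    intro x
    have h := deriv_under 0 1 (S.smooth_u1.contx t) (S.smooth_u1.d1.contx t)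
      (S.smooth_u1.hd1 t) x
    convert h using 1
    have : ∫ y in (0:ℝ)..1, d1 S.u1 t x y = ∫ y in (0:ℝ)..1, -d2 S.u2 t x y := by
      apply intervalIntegral.integral_congr
      intro y hy
      rw [uIcc_of_le zero_le_one] at hy
      have := S.incomp t x y ht hy
      simp only
      linarith
    rw [this, intervalIntegral.integral_neg,
      intervalIntegral.integral_eq_sub_of_hasDerivAt (fun y _ => S.smooth_u2.hd2 t x y)
      ((cont_right (S.smooth_u2.d2.contx t) x).intervalIntegrable _ _), S.u2_top t x ht,
      S.u2_bot t x ht]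
    simp
  have hc : ∀ z, (∫ y in (0:ℝ)..1, S.u1 t z y) = ∫ y in (0:ℝ)..1, S.u1 t x y := fun z =>
    is_const_of_deriv_eq_zero (fun r => (hd r).differentiableAt) (fun r => (hd r).deriv) z x
  rw [intΩ_eq hΓ] at hm
  simp only [hc] at hm
  simpa [hΓ.ne'] using hm

lemma mean_zero_bound {f f' : ℝ → ℝ} (hd : ∀ x, HasDerivAt f (f' x) x) (hc : Continuous f')
    (hm : ∫ y in (0:ℝ)..1, f y = 0) {x : ℝ} (hx : x ∈ Icc (0:ℝ) 1) :
    f x ^ 2 ≤ ∫ y in (0:ℝ)..1, f' y ^ 2 := by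
  have hcf : Continuous f := continuous_iff_continuousAt.2 fun x => (hd x).continuousAt
  have h1 : ∫ y in (0:ℝ)..1, (f x - f y) = f x := by
    rw [intervalIntegral.integral_sub (by simp) (hcf.intervalIntegrable _ _), hm]
    simp
  have h2 : ‖∫ y in (0:ℝ)..1, (f x - f y)‖ ≤ √(∫ y in (0:ℝ)..1, f' y ^ 2) * |1 - 0| := by
    apply intervalIntegral.norm_integral_le_of_norm_le_const
    intro y hy
    rw [uIoc_of_le zero_le_one] at hy
    exact Real.abs_le_sqrt (osc hd hc (Ioc_subset_Icc_self hy) hx)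
  rw [h1] at h2
  simp only [sub_zero, abs_one, mul_one, Real.norm_eq_abs] at h2
  have h3 : 0 ≤ ∫ y in (0:ℝ)..1, f' y ^ 2 :=
    intervalIntegral.integral_nonneg zero_le_one fun _ _ => sq_nonneg _
  rw [← sq_abs, ← Real.sq_sqrt h3]
  exact pow_le_pow_left₀ (abs_nonneg _) h2 2

lemma coercive_free {Γ Ra Pr : ℝ} (hΓ : 0 < Γ) (hPr : 0 < Pr) (S : Sol Γ Ra Pr ⊤)
    (hm : intΩ Γ (S.u1 0) = 0) (t : ℝ) (ht : 0 ≤ t) :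
    en S t ≤ 2 * (intΩ Γ (gradSq S t) + (((⊤ : ℝ≥0∞))⁻¹).toReal *
      ∫ x in (0:ℝ)..Γ, (S.u1 t x 1 ^ 2 + S.u1 t x 0 ^ 2)) := by
  have hm' : intΩ Γ (S.u1 t) = 0 := (mean_conserved hΓ hPr S t ht).trans hm
  have h1 := poinc hΓ S.smooth_u1 t (a := fun _ => 0) continuous_const 1 (by
    intro x y hy
    have := mean_zero_bound (fun y => S.smooth_u1.hd2 t x y)
      (cont_right (S.smooth_u1.d2.contx t) x) (column_zero hΓ S t ht hm' x) hy
    linarith)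
  simp only [intervalIntegral.integral_zero, zero_add, one_mul] at h1
  have h2 := poinc_u2 hΓ S t ht
  have h3 := grad_ge hΓ S t
  have h4 := intΩ_sq_nonneg (Γ := Γ) (d2 S.u1 t)
  have h5 := intΩ_sq_nonneg (Γ := Γ) (d2 S.u2 t)
  rw [en_split hΓ]
  simp only [ENNReal.inv_top, ENNReal.toReal_zero, zero_mul, add_zero]
  linarith

/-- energy, uniform-in-time bound. -/
theorem energy_uniform_bound (Γ : ℝ) (hΓ : 0 < Γ) :
    ∃ C : ℝ, 0 < C ∧
      (∀ (Ra Pr Ls : ℝ), 0 < Ra → 0 < Pr → 0 < Ls →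
        ∀ S : Sol Γ Ra Pr (ENNReal.ofReal Ls), T0cond S →
          ∀ t : ℝ, 0 ≤ t → uL2 S t ≤ uL2 S 0 + C * max 1 Ls * Ra) ∧
      (∀ (Ra Pr : ℝ), 0 < Ra → 0 < Pr →
        ∀ S : Sol Γ Ra Pr ⊤, T0cond S →
          intΩ Γ (fun x1 x2 => S.u1 0 x1 x2) = 0 →
          ∀ t : ℝ, 0 ≤ t → uL2 S t ≤ uL2 S 0 + C * Ra) := by
  have hs : 0 < √Γ := Real.sqrt_pos.2 hΓ
  refine ⟨2 * √Γ, by positivity, ?_, ?_⟩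
  · intro Ra Pr Ls hRa hPr hLs S h0 t ht
    have hm : 0 < max 1 Ls := lt_max_of_lt_left one_pos
    have := energy_general hΓ hRa hPr S h0 (2 * max 1 Ls) (by positivity)
      (coercive_slip hΓ hLs S) t ht
    calc uL2 S t ≤ uL2 S 0 + 2 * max 1 Ls * √Γ * Ra := this
      _ = _ := by ring
  · intro Ra Pr hRa hPr S h0 hm t ht
    exact energy_general hΓ hRa hPr S h0 2 two_pos (coercive_free hΓ hPr S hm) t ht

end RB
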